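/- arXiv:1907.02798 — 2 statements merged into one kernel-verified Lean document; each statement's English description precedes it below -/
import Mathlib

section
/- A group G is finite-by-nilpotent (i.e., G has a finite normal subgroup N such that G/N is nilpotent) if and only if there exist positive integers m and n such that |x^{X_n(G)}| ≤ m for every x ∈ G. -/
/-- The set of conjugates of `x` by elements of `S`: `x^S = {x^s : s ∈ S}`. -/
def conjSet {G : Type*} [Group G] (x : G) (S : Set G) : Set G :=
  (fun s => s⁻¹ * x * s) '' S

/-- The commutator `[a,b] = a⁻¹b⁻¹ab`. -/
def commP {G : Type*} [Group G] (a b : G) : G := a⁻¹ * b⁻¹ * a * b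

/-- `gammaVals G k` is the set of `γ_{k+1}`-values in `G`, i.e. elements of the form
`[x_1,…,x_{k+1}]` (left-normed commutators); so `X_n(G) = gammaVals G (n-1)`. -/
def gammaVals (G : Type*) [Group G] : ℕ → Set G
  | 0 => Set.univ
  | k + 1 => {z | ∃ x ∈ gammaVals G k, ∃ y : G, z = commP x y}

open scoped commutatorElement

section CommutatorIdentities

variable {G : Type*} [Group G]

theorem commP_eq_commutatorElement (a b : G) : commP a b = ⁅a⁻¹, b⁻¹⁆ := by
  simp [commP, commutatorElement_def]

theorem commutatorElement_eq_commP (a b : G) : ⁅a, b⁆ = commP a⁻¹ b⁻¹ := by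
  simp [commP, commutatorElement_def]

theorem commP_mul_left (a b c : G) : commP (a * b) c = b⁻¹ * commP a c * b * commP b c := by
  simp only [commP]; group

theorem conj_commP (a b g : G) :
    g⁻¹ * commP a b * g = commP (g⁻¹ * a * g) (g⁻¹ * b * g) := by
  simp only [commP]; group

theorem inv_commP (a b : G) : (commP a b)⁻¹ = commP b a := by
  simp only [commP]; group

theorem commP_eq_one_iff {a b : G} : commP a b = 1 ↔ Commute a b := by
  rw [commP_eq_commutatorElement, commutatorElement_eq_one_iff_commute, Commute.inv_inv_iff]

theorem map_commP {G' : Type*} [Group G'] (f : G →* G') (a b : G) :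
    f (commP a b) = commP (f a) (f b) := by
  simp [commP]

theorem commP_pow_left_of_commute_commP {v c : G} (h : Commute v (commP v c)) (k : ℕ) :
    commP (v ^ k) c = commP v c ^ k := by
  induction k with
  | zero => simp [commP]
  | succ k ih =>
    have h' : v⁻¹ * commP v c ^ k * v = commP v c ^ k := by
      rw [mul_assoc, ← (h.pow_right k).eq, inv_mul_cancel_left]
    rw [pow_succ, commP_mul_left, ih, h', pow_succ]

theorem commP_pow_left_of_commute_conj {d z : G} (h : Commute d (z⁻¹ * d * z)) (k : ℕ) :
    commP (d ^ k) z = commP d z ^ k := by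
  apply commP_pow_left_of_commute_commP
  have : commP d z = d⁻¹ * (z⁻¹ * d * z) := by simp only [commP]; group
  rw [this]
  exact (Commute.refl d).inv_right.mul_right h

/-- Interchanging the last two entries of a commutator of an element of an abelian normal subset. -/
theorem commP_commP_swap {S : Set G} (hconj : ∀ x ∈ S, ∀ g : G, g⁻¹ * x * g ∈ S)
    (hS : ∀ x ∈ S, ∀ y ∈ S, Commute x y) {d : G} (hd : d ∈ S) (y z : G) :
    commP (commP d z) y =
      commP (commP d y) z * ((z * y)⁻¹ * commP d (commP y⁻¹ z⁻¹) * (z * y))⁻¹ := by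
  have hz := hconj d hd z
  have hy := hconj d hd y
  have hzy := hconj d hd (z * y)
  have hyz := hconj d hd (y * z)
  set p := z⁻¹ * d * z with hp
  set q := y⁻¹ * d * y with hq
  set r := (z * y)⁻¹ * d * (z * y) with hr
  set s := (y * z)⁻¹ * d * (y * z) with hs
  have e1 : commP (commP d z) y = p⁻¹ * d * (q⁻¹ * r) := by
    simp only [commP, hp, hq, hr]; group
  have e2 : commP (commP d y) z = q⁻¹ * d * (p⁻¹ * s) := by
    simp only [commP, hp, hq, hs]; group
  have e3 : ((z * y)⁻¹ * commP d (commP y⁻¹ z⁻¹) * (z * y))⁻¹ = s⁻¹ * r := by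
    simp only [commP, hr, hs]; group
  rw [e1, e2, e3]
  have c1 : Commute (p⁻¹ * d) q⁻¹ := ((hS p hz q hy).inv_left.mul_left (hS d hd q hy)).inv_right
  have c2 : Commute p⁻¹ d := (hS p hz d hd).inv_left
  calc p⁻¹ * d * (q⁻¹ * r) = (p⁻¹ * d * q⁻¹) * r := by group
    _ = q⁻¹ * (p⁻¹ * d) * r := by rw [c1.eq]
    _ = q⁻¹ * (d * p⁻¹) * r := by rw [c2.eq]
    _ = q⁻¹ * d * (p⁻¹ * s) * (s⁻¹ * r) := by group

end CommutatorIdentities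

section GammaVals

variable {G : Type*} [Group G]

theorem commP_mem_gammaVals_succ {k : ℕ} {x : G} (hx : x ∈ gammaVals G k) (y : G) :
    commP x y ∈ gammaVals G (k + 1) :=
  ⟨x, hx, y, rfl⟩

theorem gammaVals_succ_subset (k : ℕ) : gammaVals G (k + 1) ⊆ gammaVals G k := by
  induction k with
  | zero => exact Set.subset_univ _
  | succ k ih =>
    rintro _ ⟨x, hx, y, rfl⟩
    exact commP_mem_gammaVals_succ (ih hx) y

theorem gammaVals_antitone : Antitone (gammaVals G) :=
  antitone_nat_of_succ_le gammaVals_succ_subset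

theorem conj_mem_gammaVals {k : ℕ} {x : G} (hx : x ∈ gammaVals G k) (g : G) :
    g⁻¹ * x * g ∈ gammaVals G k := by
  induction k generalizing x with
  | zero => trivial
  | succ k ih =>
    obtain ⟨x, hx, y, rfl⟩ := hx
    rw [conj_commP]
    exact commP_mem_gammaVals_succ (ih hx) _

theorem inv_mem_gammaVals {k : ℕ} {x : G} (hx : x ∈ gammaVals G k) : x⁻¹ ∈ gammaVals G k := by
  cases k with
  | zero => trivial
  | succ k =>
    obtain ⟨x, hx, y, rfl⟩ := hx
    have : (commP x y)⁻¹ = y⁻¹ * commP x y⁻¹ * y := by simp only [commP]; group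
    rw [this]
    exact conj_mem_gammaVals (commP_mem_gammaVals_succ hx _) y

theorem image_gammaVals {G' : Type*} [Group G'] (f : G →* G') (hf : Function.Surjective f)
    (k : ℕ) : f '' gammaVals G k = gammaVals G' k := by
  induction k with
  | zero => simpa [gammaVals] using! hf.range_eq
  | succ k ih =>
    ext w
    constructor
    · rintro ⟨_, ⟨x, hx, y, rfl⟩, rfl⟩
      rw [map_commP]
      exact commP_mem_gammaVals_succ (ih ▸ Set.mem_image_of_mem f hx) _
    · rintro ⟨x', hx', y', rfl⟩
      rw [← ih] at hx'
      obtain ⟨x, hx, rfl⟩ := hx'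
      obtain ⟨y, rfl⟩ := hf y'
      exact ⟨_, commP_mem_gammaVals_succ hx y, map_commP f x y⟩

theorem closure_normal_of_conj_mem {S : Set G} (hS : ∀ x ∈ S, ∀ g : G, g⁻¹ * x * g ∈ S) :
    (Subgroup.closure S).Normal := by
  have : Group.conjugatesOfSet S = S := by
    refine Set.Subset.antisymm (fun x hx ↦ ?_) Group.subset_conjugatesOfSet
    obtain ⟨s, hs, hsx⟩ := Group.mem_conjugatesOfSet_iff.1 hx
    obtain ⟨g, rfl⟩ := isConj_iff.1 hsx
    simpa using hS s hs g⁻¹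
  have h : Subgroup.closure S = Subgroup.normalClosure S := by rw [Subgroup.normalClosure, this]
  rw [h]
  infer_instance

instance closure_gammaVals_normal (k : ℕ) : (Subgroup.closure (gammaVals G k)).Normal :=
  closure_normal_of_conj_mem fun _ hx g ↦ conj_mem_gammaVals hx g

theorem gammaVals_subset_lowerCentralSeries (k : ℕ) :
    gammaVals G k ⊆ (⊤ : Subgroup G).lowerCentralSeries k := by
  induction k with
  | zero => exact fun _ _ ↦ Subgroup.mem_top _
  | succ k ih =>
    rintro _ ⟨x, hx, y, rfl⟩
    rw [commP_eq_commutatorElement]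
    exact Subgroup.commutator_mem_commutator (inv_mem (ih hx)) (Subgroup.mem_top _)

theorem isNilpotent_of_gammaVals_subset_one {n : ℕ} (h : gammaVals G n ⊆ {1}) :
    Group.IsNilpotent G := by
  have key : ∀ k ≤ n, gammaVals G (n - k) ⊆ Subgroup.upperCentralSeries G k := by
    intro k
    induction k with
    | zero => intro _; simpa using! h
    | succ k ih =>
      intro hk x hx
      rw [SetLike.mem_coe, Subgroup.mem_upperCentralSeries_succ_iff]
      intro y
      rw [commutatorElement_eq_commP]
      apply ih (by omega)
      have := commP_mem_gammaVals_succ (inv_mem_gammaVals hx) y⁻¹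
      rwa [show n - (k + 1) + 1 = n - k by omega] at this
  refine ⟨n, eq_top_iff.2 fun x _ ↦ key n le_rfl ?_⟩
  rw [Nat.sub_self]
  trivial

end GammaVals

section FiniteSets

variable {G : Type*} [Group G]

theorem finite_commutator_of_finite_image {α : Type*} (φ : G → α) (H T : Subgroup G) [T.Normal]
    [Finite T] (hφ : (φ '' H).Finite)
    (h : ∀ a ∈ H, ∀ b ∈ H, φ a = φ b → ∀ c ∈ H, commP (a * b⁻¹) c ∈ T) :
    Finite (⁅H, H⁆ : Subgroup G) := by
  obtain ⟨R, hRH, hR⟩ := Set.exists_subset_bijOn (H : Set G) φ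
  have hRfin : R.Finite := hR.finite_iff_finite.2 hφ
  have hrep : ∀ a ∈ H, ∃ r ∈ R, ∀ c ∈ H, commP (a * r⁻¹) c ∈ T := by
    intro a ha
    obtain ⟨r, hr, hra⟩ := hR.surjOn (Set.mem_image_of_mem φ ha)
    exact ⟨r, hr, h a ha r (hRH hr) hra.symm⟩
  have hfin : (Set.image2 (· * ·) (Set.image2 commP R R) (T : Set G)).Finite :=
    (hRfin.image2 _ hRfin).image2 _ (Set.toFinite _)
  have hmem : ∀ a ∈ H, ∀ b ∈ H,
      commP a b ∈ Set.image2 (· * ·) (Set.image2 commP R R) (T : Set G) := by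
    intro a ha b hb
    obtain ⟨r, hr, hra⟩ := hrep a ha
    obtain ⟨s, hs, hsb⟩ := hrep b hb
    refine ⟨_, ⟨r, hr, s, hs, rfl⟩, (commP r s)⁻¹ * commP a b, ?_, by simp⟩
    have e1 : (QuotientGroup.mk' T) (commP (a * r⁻¹) b) = 1 :=
      (QuotientGroup.eq_one_iff _).2 (hra b hb)
    have e2 : (QuotientGroup.mk' T) (commP (b * s⁻¹) r) = 1 :=
      (QuotientGroup.eq_one_iff _).2 (hsb r (hRH hr))
    have ea : commP a b = r⁻¹ * commP (a * r⁻¹) b * r * commP r b := by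
      rw [← commP_mul_left, inv_mul_cancel_right]
    have eb : commP b r = s⁻¹ * commP (b * s⁻¹) r * s * commP s r := by
      rw [← commP_mul_left, inv_mul_cancel_right]
    refine (QuotientGroup.eq_one_iff (N := T) _).1 (?_ : (QuotientGroup.mk' T) _ = 1)
    rw [ea, ← inv_commP b r, eb, ← inv_commP s r]
    simp only [map_mul, map_inv, e1, e2]
    group
  have : Finite (commutatorSet H) := by
    apply Set.Finite.subset (hfin.preimage (f := H.subtype) (Subtype.val_injective.injOn))
    rintro _ ⟨a, b, rfl⟩
    have := hmem _ (inv_mem a.2) _ (inv_mem b.2)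
    rw [← commutatorElement_eq_commP] at this
    simpa [commutatorElement_def] using! this
  rw [← Subgroup.map_subtype_commutator]
  exact Finite.of_equiv _ ((commutator H).equivMapOfInjective _ H.subtype_injective).toEquiv

theorem finite_image_conj {S B : Set G} (hB : B.Finite) (hS : ∀ b ∈ B, (conjSet b S).Finite) :
    ((fun (g : G) (b : B) ↦ g⁻¹ * (b : G) * g) '' S).Finite := by
  have := hB.to_subtype
  refine (Set.Finite.pi' (t := fun b : B ↦ conjSet (b : G) S) fun b ↦ hS b b.2).subset ?_
  rintro _ ⟨g, hg, rfl⟩ b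
  exact ⟨g, hg, rfl⟩

theorem commute_mul_inv_of_conj_eq {b r s : G} (h : r⁻¹ * b * r = s⁻¹ * b * s) :
    Commute (r * s⁻¹) b := by
  have : b * r = r * (s⁻¹ * b * s) := by rw [← h]; group
  calc r * s⁻¹ * b = r * (s⁻¹ * b * s) * s⁻¹ := by group
    _ = b * (r * s⁻¹) := by rw [← this]; group

theorem finite_commutator_closure {Q : Set G} (hQ : Q.Finite)
    (hconj : ∀ x ∈ Q, ∀ g : G, g⁻¹ * x * g ∈ Q) :
    Finite (⁅Subgroup.closure Q, Subgroup.closure Q⁆ : Subgroup G) := by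
  apply finite_commutator_of_finite_image (fun (g : G) (b : Q) ↦ g⁻¹ * (b : G) * g) _ ⊥
  · exact finite_image_conj hQ fun b hb ↦ hQ.subset (by rintro _ ⟨g, -, rfl⟩; exact hconj b hb g)
  · intro a _ b _ hab c hc
    rw [Subgroup.mem_bot, commP_eq_one_iff]
    have : a * b⁻¹ ∈ Subgroup.centralizer (Subgroup.closure Q : Set G) := by
      rw [Subgroup.centralizer_closure, Subgroup.mem_centralizer_iff]
      exact fun q hq ↦ (commute_mul_inv_of_conj_eq (congrFun hab ⟨q, hq⟩)).eq.symm
    exact (Subgroup.mem_centralizer_iff.1 this c hc).symm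

/-- **Dietzmann's lemma**: a finite normal set of elements of finite order generates a finite
subgroup. -/
theorem finite_closure_of_isOfFinOrder {Q : Set G} (hQ : Q.Finite)
    (hconj : ∀ x ∈ Q, ∀ g : G, g⁻¹ * x * g ∈ Q) (htor : ∀ x ∈ Q, IsOfFinOrder x) :
    Finite (Subgroup.closure Q) := by
  have := hQ.to_subtype
  have h1 := finite_commutator_closure hQ hconj
  rw [← Subgroup.map_subtype_commutator] at h1
  set H := Subgroup.closure Q
  have : Finite (commutator H) :=
    Finite.of_equiv _ ((commutator H).equivMapOfInjective _ H.subtype_injective).symm.toEquiv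
  have htorH : ∀ x : H, IsOfFinOrder (Abelianization.of x) := by
    rintro ⟨x, hx⟩
    induction hx using Subgroup.closure_induction with
    | mem x hx =>
      apply MonoidHom.isOfFinOrder
      rw [← Submonoid.isOfFinOrder_coe]
      exact htor x hx
    | one => exact MonoidHom.isOfFinOrder _ IsOfFinOrder.one
    | mul x y hx hy ihx ihy =>
      have : Abelianization.of (⟨x * y, mul_mem hx hy⟩ : H) =
        Abelianization.of ⟨x, hx⟩ * Abelianization.of ⟨y, hy⟩ := by rw [← map_mul]; rfl
      rw [this]
      exact ihx.mul ihy
    | inv x hx ih =>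
      have : Abelianization.of (⟨x⁻¹, inv_mem hx⟩ : H) = (Abelianization.of ⟨x, hx⟩)⁻¹ := by
        rw [← map_inv]; rfl
      rw [this]
      exact ih.inv
  have : Group.FG H := Group.closure_finite_fg Q
  have : Group.FG (Abelianization H) := QuotientGroup.fg (commutator H)
  have : Finite (Abelianization H) := by
    apply CommGroup.finite_of_fg_isMulTorsion
    intro x
    obtain ⟨x, rfl⟩ := QuotientGroup.mk_surjective x
    exact htorH x
  have : Finite (H ⧸ commutator H) := this
  exact Finite.of_subgroup_quotient (commutator H)

theorem isOfFinOrder_of_pow_mem_finite {x : G} {F : Set G} (hF : F.Finite)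
    (h : ∀ k : ℕ, x ^ k ∈ F) : IsOfFinOrder x := by
  by_contra hx
  exact Set.infinite_of_injective_forall_mem (injective_pow_iff_not_isOfFinOrder.2 hx) h hF

end FiniteSets

section FinitelyManyValues

variable {G : Type*} [Group G]

theorem pow_mem_gammaVals {n : ℕ}
    (hcomm : ∀ x ∈ gammaVals G n, ∀ y ∈ gammaVals G n, Commute x y) (k : ℕ) {e : G}
    (he : e ∈ gammaVals G (n + k)) (j : ℕ) : e ^ j ∈ gammaVals G k := by
  induction k generalizing e with
  | zero => trivial
  | succ k ih =>
    obtain ⟨d, hd, z, rfl⟩ := he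
    have hdn : d ∈ gammaVals G n := gammaVals_antitone (Nat.le_add_right n k) hd
    rw [← commP_pow_left_of_commute_conj (hcomm _ hdn _ (conj_mem_gammaVals hdn z))]
    exact commP_mem_gammaVals_succ (ih hd) z

theorem commute_of_mem_gammaVals_quotient {n : ℕ} (N : Subgroup G) [N.Normal]
    (hN : ⁅Subgroup.closure (gammaVals G n), Subgroup.closure (gammaVals G n)⁆ ≤ N) :
    ∀ x ∈ gammaVals (G ⧸ N) n, ∀ y ∈ gammaVals (G ⧸ N) n, Commute x y := by
  rw [← image_gammaVals (QuotientGroup.mk' N) (QuotientGroup.mk'_surjective N)]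
  rintro _ ⟨x, hx, rfl⟩ _ ⟨y, hy, rfl⟩
  rw [← commutatorElement_eq_one_iff_commute, ← map_commutatorElement]
  exact (QuotientGroup.eq_one_iff _).2 (hN (Subgroup.commutator_mem_commutator
    (Subgroup.subset_closure hx) (Subgroup.subset_closure hy)))

/-- If a group has finitely many values of a lower central word, then some later term of its lower
central series is finite. -/
theorem finite_closure_gammaVals_of_finite {n : ℕ} (h : (gammaVals G n).Finite) :
    Finite (Subgroup.closure (gammaVals G (n + n))) := by
  have hsub : gammaVals G (n + n) ⊆ gammaVals G n := gammaVals_antitone (Nat.le_add_right n n)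
  refine finite_closure_of_isOfFinOrder (h.subset hsub) (fun _ hx g ↦ conj_mem_gammaVals hx g) ?_
  intro x hx
  have hfin := finite_commutator_closure h fun _ hx g ↦ conj_mem_gammaVals hx g
  set N := ⁅Subgroup.closure (gammaVals G n), Subgroup.closure (gammaVals G n)⁆
  have himage := image_gammaVals (QuotientGroup.mk' N) (QuotientGroup.mk'_surjective N)
  have hx' : QuotientGroup.mk' N x ∈ gammaVals (G ⧸ N) (n + n) :=
    himage (n + n) ▸ Set.mem_image_of_mem _ hx
  have hord : IsOfFinOrder (QuotientGroup.mk' N x) :=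
    isOfFinOrder_of_pow_mem_finite (himage n ▸ h.image _)
      (pow_mem_gammaVals (commute_of_mem_gammaVals_quotient N le_rfl) n hx')
  obtain ⟨k, hk, hxk⟩ := isOfFinOrder_iff_pow_eq_one.1 hord
  have hmem : x ^ k ∈ N := by
    rw [← map_pow] at hxk
    exact (QuotientGroup.eq_one_iff _).1 hxk
  have : IsOfFinOrder (x ^ k) :=
    Submonoid.isOfFinOrder_coe.2 (isOfFinOrder_of_finite (⟨_, hmem⟩ : N))
  exact (isOfFinOrder_pow.1 this).resolve_right hk.ne'

end FinitelyManyValues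

section BoundedConjugates

variable {G : Type*} [Group G] {S : Set G} {m : ℕ}

theorem finite_commP_image (hS : ∀ x : G, (conjSet x S).Finite) (x : G) :
    (commP x '' S).Finite := by
  refine ((hS x).image (x⁻¹ * ·)).subset ?_
  rintro _ ⟨c, hc, rfl⟩
  exact ⟨_, ⟨c, hc, rfl⟩, by simp only [commP]; group⟩

theorem finite_commP_image_left (hS : ∀ x : G, (conjSet x S).Finite) (x : G) :
    ((fun c ↦ commP c x) '' S).Finite := by
  refine ((finite_commP_image hS x).image (·⁻¹)).subset ?_
  rintro _ ⟨c, hc, rfl⟩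
  exact ⟨_, ⟨c, hc, rfl⟩, inv_commP x c⟩

/-- An element whose number of `S`-conjugates is largest yields a finite subset `B` of `S` such
that the centralizer of `B` has only finitely many commutators with `S`. -/
theorem exists_finite_centralizer_commP
    (hS : ∀ x : G, (conjSet x S).Finite ∧ (conjSet x S).ncard ≤ m) :
    ∃ B ⊆ S, B.Finite ∧ ∃ F : Set G, F.Finite ∧
      ∀ u : G, (∀ b ∈ B, Commute u b) → ∀ c ∈ S, commP u c ∈ F := by
  obtain ⟨a, ha⟩ : ∃ a : G, ∀ x : G, (conjSet x S).ncard ≤ (conjSet a S).ncard := by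
    have hbdd : BddAbove (Set.range fun x : G ↦ (conjSet x S).ncard) :=
      ⟨m, by rintro _ ⟨x, rfl⟩; exact (hS x).2⟩
    obtain ⟨a, ha⟩ := Nat.sSup_mem (Set.range_nonempty _) hbdd
    exact ⟨a, fun x ↦ (le_csSup hbdd ⟨x, rfl⟩).trans_eq ha.symm⟩
  obtain ⟨B, hBS, hB⟩ := Set.exists_subset_bijOn S fun s ↦ s⁻¹ * a * s
  have hBfin : B.Finite := hB.finite_iff_finite.2 (hS a).1
  refine ⟨B, hBS, hBfin, Set.image2 (fun x y ↦ x * y⁻¹) (conjSet a S) (conjSet a S),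
    (hS a).1.image2 _ (hS a).1, fun u hu c hc ↦ ?_⟩
  have hconj : ∀ b ∈ B, b⁻¹ * (u * a) * b = u * (b⁻¹ * a * b) := fun b hb ↦ by
    rw [← mul_assoc, ← (hu b hb).inv_right.eq]
    group
  have hsub : (u * ·) '' conjSet a S ⊆ conjSet (u * a) S := by
    rintro _ ⟨_, hx, rfl⟩
    obtain ⟨b, hb, rfl⟩ := hB.surjOn hx
    exact ⟨b, hBS hb, hconj b hb⟩
  have heq : (u * ·) '' conjSet a S = conjSet (u * a) S := by
    refine Set.eq_of_subset_of_ncard_le hsub ?_ (hS _).1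
    rw [Set.ncard_image_of_injective _ (mul_right_injective u)]
    exact ha _
  have hmem : c⁻¹ * (u * a) * c ∈ (u * ·) '' conjSet a S := heq ▸ ⟨c, hc, rfl⟩
  obtain ⟨y, hy, hyc⟩ := hmem
  refine ⟨y, hy, c⁻¹ * a * c, ⟨c, hc, rfl⟩, ?_⟩
  have : y = u⁻¹ * (c⁻¹ * (u * a) * c) := by rw [← hyc]; group
  simp only [this, commP]
  group

theorem finite_image2_commP (hS : ∀ x : G, (conjSet x S).Finite ∧ (conjSet x S).ncard ≤ m)
    {R : Set G} (hR : ∀ b ∈ S, (conjSet b R).Finite) : (Set.image2 commP R S).Finite := by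
  obtain ⟨B, hBS, hB, F, hF, hBF⟩ := exists_finite_centralizer_commP hS
  set φ : G → B → G := fun g b ↦ g⁻¹ * (b : G) * g
  have hφ : (φ '' R).Finite := finite_image_conj hB fun b hb ↦ hR b (hBS hb)
  obtain ⟨R₀, hR₀, hbij⟩ := Set.exists_subset_bijOn R φ
  have hR₀fin : R₀.Finite := hbij.finite_iff_finite.2 hφ
  refine (hR₀fin.biUnion fun r _ ↦ hF.image2 (fun f e ↦ r⁻¹ * f * r * e)
    (finite_commP_image (fun x ↦ (hS x).1) r)).subset ?_
  rintro _ ⟨g, hg, c, hc, rfl⟩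
  obtain ⟨r, hr, hrg⟩ := hbij.surjOn (Set.mem_image_of_mem φ hg)
  refine Set.mem_biUnion hr ⟨commP (g * r⁻¹) c, hBF _ (fun b hb ↦ ?_) c hc, commP r c,
    ⟨c, hc, rfl⟩, ?_⟩
  · exact commute_mul_inv_of_conj_eq (congrFun hrg.symm ⟨b, hb⟩)
  · simp only [← commP_mul_left, inv_mul_cancel_right]

theorem conjSet_gammaVals_mono {n k : ℕ} (hnk : n ≤ k)
    (h : ∀ x : G, (conjSet x (gammaVals G n)).Finite ∧ (conjSet x (gammaVals G n)).ncard ≤ m)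
    (x : G) : (conjSet x (gammaVals G k)).Finite ∧ (conjSet x (gammaVals G k)).ncard ≤ m := by
  have hsub : conjSet x (gammaVals G k) ⊆ conjSet x (gammaVals G n) :=
    Set.image_mono (gammaVals_antitone hnk)
  exact ⟨(h x).1.subset hsub, (Set.ncard_le_ncard hsub (h x).1).trans (h x).2⟩

theorem conjSet_gammaVals_map {G' : Type*} [Group G'] (f : G →* G') (hf : Function.Surjective f)
    {n : ℕ}
    (h : ∀ x : G, (conjSet x (gammaVals G n)).Finite ∧ (conjSet x (gammaVals G n)).ncard ≤ m)
    (x : G') :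
    (conjSet x (gammaVals G' n)).Finite ∧ (conjSet x (gammaVals G' n)).ncard ≤ m := by
  obtain ⟨x, rfl⟩ := hf x
  have : conjSet (f x) (gammaVals G' n) = f '' conjSet x (gammaVals G n) := by
    rw [← image_gammaVals f hf, conjSet, conjSet, Set.image_image, Set.image_image]
    simp
  rw [this]
  exact ⟨(h x).1.image f, (Set.ncard_image_le (h x).1).trans (h x).2⟩

theorem exists_finite_commutator_closure_gammaVals {n : ℕ}
    (h : ∀ x : G, (conjSet x (gammaVals G n)).Finite ∧ (conjSet x (gammaVals G n)).ncard ≤ m) :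
    ∃ k ≥ n, Finite
      (⁅Subgroup.closure (gammaVals G k), Subgroup.closure (gammaVals G k)⁆ : Subgroup G) := by
  set S := gammaVals G n
  obtain ⟨B, hBS, hB, F, hF, hBF⟩ := exists_finite_centralizer_commP h
  set R : Set G := Set.image2 (fun r s ↦ r * s⁻¹) S S
  set Q : Set G := Set.image2 commP R S
  have hQ : Q.Finite := by
    refine finite_image2_commP h fun b _ ↦ ?_
    refine ((h b).1.biUnion fun x _ ↦ (h x).1).subset ?_
    rintro _ ⟨_, ⟨r, hr, s, hs, rfl⟩, rfl⟩
    exact Set.mem_biUnion ⟨r, hr, rfl⟩ ⟨s⁻¹, inv_mem_gammaVals hs, by simp only; group⟩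
  have hQconj : ∀ x ∈ Q, ∀ g : G, g⁻¹ * x * g ∈ Q := by
    rintro _ ⟨_, ⟨r, hr, s, hs, rfl⟩, c, hc, rfl⟩ g
    rw [conj_commP]
    exact ⟨_, ⟨_, conj_mem_gammaVals hr g, _, conj_mem_gammaVals hs g, by simp only; group⟩,
      _, conj_mem_gammaVals hc g, rfl⟩
  set Q₀ : Set G := {x ∈ Q | IsOfFinOrder x}
  have hQ₀conj : ∀ x ∈ Q₀, ∀ g : G, g⁻¹ * x * g ∈ Q₀ := fun x hx g ↦
    ⟨hQconj x hx.1 g, by simpa using (MulAut.conj g⁻¹).toMonoidHom.isOfFinOrder hx.2⟩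
  set T := Subgroup.closure Q₀
  have : Finite T :=
    finite_closure_of_isOfFinOrder (hQ.subset fun _ hx ↦ hx.1) hQ₀conj fun _ hx ↦ hx.2
  have : T.Normal := closure_normal_of_conj_mem hQ₀conj
  set HT := (Subgroup.closure S).map (QuotientGroup.mk' T) with hHT
  have : HT.Normal :=
    Subgroup.Normal.map (closure_gammaVals_normal n) _ (QuotientGroup.mk'_surjective T)
  set M := (Subgroup.centralizer (HT : Set (G ⧸ T))).comap (QuotientGroup.mk' T) with hM
  have hMT : ∀ g ∈ M, ∀ c ∈ Subgroup.closure S, commP g c ∈ T := by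
    intro g hg c hc
    refine (QuotientGroup.eq_one_iff (N := T) _).1 (?_ : (QuotientGroup.mk' T) _ = 1)
    rw [map_commP, commP_eq_one_iff]
    exact (Subgroup.mem_centralizer_iff.1 hg _ (Subgroup.mem_map_of_mem _ hc)).symm
  have hTM : ∀ g : G, (∀ c ∈ S, commP g c ∈ T) → g ∈ M := by
    intro g hg
    rw [hM, Subgroup.mem_comap, hHT, MonoidHom.map_closure, Subgroup.centralizer_closure,
      Subgroup.mem_centralizer_iff]
    rintro _ ⟨c, hc, rfl⟩
    refine (commP_eq_one_iff.1 ?_).eq.symm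
    rw [← map_commP]
    exact (QuotientGroup.eq_one_iff _).2 (hg c hc)
  have hBQ : (B ∪ Q).Finite := hB.union hQ
  have hφ := finite_image_conj (S := S) hBQ fun b _ ↦ (h b).1
  set φ : G → ↥(B ∪ Q) → G := fun g b ↦ g⁻¹ * (b : G) * g
  have hφM : ∀ r ∈ S, ∀ s ∈ S, φ r = φ s → r * s⁻¹ ∈ M := by
    intro r hr s hs hrs
    have hcomm : ∀ b ∈ B ∪ Q, Commute (r * s⁻¹) b := fun b hb ↦
      commute_mul_inv_of_conj_eq (congrFun hrs ⟨b, hb⟩)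
    refine hTM _ fun c hc ↦ Subgroup.subset_closure ?_
    have hcQ : commP (r * s⁻¹) c ∈ Q := ⟨_, ⟨r, hr, s, hs, rfl⟩, c, hc, rfl⟩
    refine ⟨hcQ, isOfFinOrder_of_pow_mem_finite hF fun k ↦ ?_⟩
    rw [← commP_pow_left_of_commute_commP (hcomm _ (Or.inr hcQ))]
    exact hBF _ (fun b hb ↦ (hcomm b (Or.inl hb)).pow_left k) c hc
  have hfin : (gammaVals (G ⧸ M) n).Finite := by
    rw [← image_gammaVals (QuotientGroup.mk' M) (QuotientGroup.mk'_surjective M)]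
    obtain ⟨S₀, hS₀, hbij⟩ := Set.exists_subset_bijOn S φ
    refine ((hbij.finite_iff_finite.2 hφ).image (QuotientGroup.mk' M)).subset ?_
    rintro _ ⟨s, hs, rfl⟩
    obtain ⟨r, hr, hrs⟩ := hbij.surjOn (Set.mem_image_of_mem φ hs)
    refine ⟨r, hr, ?_⟩
    have := hφM r (hS₀ hr) s hs hrs
    rw [← mul_inv_eq_one, ← map_inv, ← map_mul]
    exact (QuotientGroup.eq_one_iff _).2 this
  have hfin' := finite_closure_gammaVals_of_finite hfin
  refine ⟨n + n, Nat.le_add_right n n,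
    finite_commutator_of_finite_image (QuotientGroup.mk' M) _ T ?_ ?_⟩
  · rw [← Subgroup.coe_map, MonoidHom.map_closure,
      image_gammaVals _ (QuotientGroup.mk'_surjective M)]
    exact Set.toFinite _
  · intro a _ b _ hab c hc
    refine hMT _ ?_ c (Subgroup.closure_mono (gammaVals_antitone (Nat.le_add_right n n)) hc)
    rw [← mul_inv_eq_one, ← map_inv, ← map_mul] at hab
    exact (QuotientGroup.eq_one_iff _).1 hab

/-- If the `γ`-values of a given weight commute, then the commutators of a fixed `γ`-value of
sufficiently large weight with arbitrary elements form a finite set. -/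
theorem finite_conj_commP_gammaVals {n : ℕ}
    (h : ∀ x : G, (conjSet x (gammaVals G n)).Finite)
    (hcomm : ∀ x ∈ gammaVals G n, ∀ y ∈ gammaVals G n, Commute x y) (j : ℕ) (hj : j ≤ n)
    {d : G} (hd : d ∈ gammaVals G (n + j)) :
    {e : G | ∃ w ∈ gammaVals G (n - j), ∃ g : G, e = g⁻¹ * commP d w * g}.Finite := by
  induction j generalizing d with
  | zero =>
    refine (Set.finite_singleton (1 : G)).subset ?_
    rintro _ ⟨w, hw, g, rfl⟩
    simp [commP_eq_one_iff.2 (hcomm d hd w hw)]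
  | succ j ih =>
    have hswap := fun {d : G} (hd : d ∈ gammaVals G n) ↦ commP_commP_swap
      (fun _ hx g ↦ conj_mem_gammaVals hx g) hcomm hd
    have hw : ∀ z ∈ gammaVals G (n - (j + 1)), ∀ y : G,
        commP y⁻¹ z⁻¹ ∈ gammaVals G (n - j) := by
      intro z hz y
      have := inv_mem_gammaVals (commP_mem_gammaVals_succ (inv_mem_gammaVals hz) y⁻¹)
      rwa [inv_commP, show n - (j + 1) + 1 = n - j by omega] at this
    have hdj : d ∈ gammaVals G (n + j) := gammaVals_succ_subset _ hd
    have hdn : d ∈ gammaVals G n := gammaVals_antitone (Nat.le_add_right n j) hdj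
    have horbit : ∀ z ∈ gammaVals G (n - (j + 1)),
        {e : G | ∃ g : G, e = g⁻¹ * commP d z * g}.Finite := by
      intro z hz
      refine (((finite_commP_image_left h z).image2 (fun a b ↦ a * b⁻¹)
        (ih (by omega) hdj)).image (commP d z * ·)).subset ?_
      rintro _ ⟨g, rfl⟩
      refine ⟨_, ⟨_, ⟨commP d g, gammaVals_succ_subset _ (commP_mem_gammaVals_succ hdn g), rfl⟩,
        _, ⟨_, hw z hz g, z * g, rfl⟩, rfl⟩, ?_⟩
      simp only [← hswap hdn g z]
      simp only [commP]
      group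
    have hvals : (commP d '' gammaVals G (n - (j + 1))).Finite := by
      obtain ⟨d', hd', y, rfl⟩ := hd
      have hd'n : d' ∈ gammaVals G n := gammaVals_antitone (Nat.le_add_right n j) hd'
      refine ((finite_commP_image_left h y).image2 (fun a b ↦ a * b)
        (ih (by omega) hd')).subset ?_
      rintro _ ⟨z, hz, rfl⟩
      refine ⟨_, ⟨commP d' z, gammaVals_succ_subset _ (commP_mem_gammaVals_succ hd'n z), rfl⟩,
        _, ⟨_, hw z hz y, z * y, rfl⟩, ?_⟩
      simp only [hswap hd'n y z, inv_mul_cancel_right]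
    obtain ⟨Z, hZ, hbij⟩ := Set.exists_subset_bijOn (gammaVals G (n - (j + 1))) (commP d)
    refine ((hbij.finite_iff_finite.2 hvals).biUnion fun z hz ↦ horbit z (hZ hz)).subset ?_
    rintro _ ⟨w, hw, g, rfl⟩
    obtain ⟨z, hz, hzw⟩ := hbij.surjOn (Set.mem_image_of_mem _ hw)
    exact Set.mem_biUnion hz ⟨g, by rw [hzw]⟩

theorem finite_gammaVals_of_commute {n : ℕ}
    (h : ∀ x : G, (conjSet x (gammaVals G n)).Finite ∧ (conjSet x (gammaVals G n)).ncard ≤ m)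
    (hcomm : ∀ x ∈ gammaVals G n, ∀ y ∈ gammaVals G n, Commute x y) :
    (gammaVals G (n + n + 1)).Finite := by
  have hfin : (Set.image2 commP Set.univ (gammaVals G (n + n))).Finite := by
    refine finite_image2_commP (conjSet_gammaVals_mono (Nat.le_add_right n n) h) fun d hd ↦ ?_
    refine ((finite_conj_commP_gammaVals (fun x ↦ (h x).1) hcomm n le_rfl hd).image
      (d * ·)).subset ?_
    rintro _ ⟨g, -, rfl⟩
    refine ⟨commP d g, ⟨g, by rw [Nat.sub_self]; trivial, 1, by group⟩, ?_⟩
    simp only [commP]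
    group
  refine (hfin.image (·⁻¹)).subset ?_
  rintro _ ⟨d, hd, y, rfl⟩
  exact ⟨_, ⟨y, trivial, d, hd, rfl⟩, inv_commP y d⟩

theorem exists_finite_closure_gammaVals {n : ℕ}
    (h : ∀ x : G, (conjSet x (gammaVals G n)).Finite ∧ (conjSet x (gammaVals G n)).ncard ≤ m) :
    ∃ k, Finite (Subgroup.closure (gammaVals G k)) := by
  obtain ⟨k, hk, hfin⟩ := exists_finite_commutator_closure_gammaVals h
  set N := ⁅Subgroup.closure (gammaVals G k), Subgroup.closure (gammaVals G k)⁆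
  have hsurj := QuotientGroup.mk'_surjective N
  have hquot : (gammaVals (G ⧸ N) (k + k + 1)).Finite :=
    finite_gammaVals_of_commute
      (conjSet_gammaVals_map (QuotientGroup.mk' N) hsurj (conjSet_gammaVals_mono hk h))
      (commute_of_mem_gammaVals_quotient N le_rfl)
  rw [← image_gammaVals (QuotientGroup.mk' N) hsurj] at hquot
  refine ⟨_, finite_closure_gammaVals_of_finite (n := k + k + 1) ?_⟩
  refine Set.Finite.of_finite_fibers (QuotientGroup.mk' N) hquot ?_
  rintro _ ⟨x, -, rfl⟩
  refine ((Set.toFinite (N : Set G)).image (x * ·)).subset ?_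
  rintro y ⟨-, hy⟩
  exact ⟨x⁻¹ * y, QuotientGroup.eq.1 (Eq.symm hy), by simp⟩

end BoundedConjugates

/-- A group `G` is finite-by-nilpotent (i.e. `G` has a finite normal subgroup `N` such that
`G/N` is nilpotent) if and only if there exist positive integers `m` and `n` such that
`|x^{X_n(G)}| ≤ m` for every `x ∈ G`. -/
theorem finiteByNilpotent_iff_bounded_value_conjugates (G : Type*) [Group G] :
    (∃ (N : Subgroup G) (_ : N.Normal), Finite N ∧ Group.IsNilpotent (G ⧸ N)) ↔
    (∃ m n : ℕ, 0 < m ∧ 0 < n ∧ ∀ x : G, (conjSet x (gammaVals G (n - 1))).Finite ∧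
      (conjSet x (gammaVals G (n - 1))).ncard ≤ m) := by
  constructor
  · rintro ⟨N, hN, hfin, hnil⟩
    obtain ⟨k, hk⟩ := Subgroup.nilpotent_iff_lowerCentralSeries.1 hnil
    have hsub : gammaVals G k ⊆ N := by
      intro x hx
      have hx' : QuotientGroup.mk' N x ∈ gammaVals (G ⧸ N) k :=
        image_gammaVals (QuotientGroup.mk' N) (QuotientGroup.mk'_surjective N) k ▸
          Set.mem_image_of_mem _ hx
      have := gammaVals_subset_lowerCentralSeries k hx'
      rw [hk] at this
      exact (QuotientGroup.eq_one_iff _).1 this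
    have hvals : (gammaVals G k).Finite := (Set.toFinite (N : Set G)).subset hsub
    refine ⟨(gammaVals G k).ncard + 1, k + 1, Nat.succ_pos _, Nat.succ_pos _, fun x ↦ ?_⟩
    rw [Nat.add_sub_cancel]
    exact ⟨hvals.image _, (Set.ncard_image_le hvals).trans (Nat.le_succ _)⟩
  · rintro ⟨m, n, -, -, h⟩
    obtain ⟨k, hk⟩ := exists_finite_closure_gammaVals h
    refine ⟨Subgroup.closure (gammaVals G k), inferInstance, hk, ?_⟩
    apply isNilpotent_of_gammaVals_subset_one (n := k)
    rw [← image_gammaVals (QuotientGroup.mk' _) (QuotientGroup.mk'_surjective _)]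
    rintro _ ⟨x, hx, rfl⟩
    exact (QuotientGroup.eq_one_iff _).2 (Subgroup.subset_closure hx)
end

section
/- (B. H. Neumann's theorem) For every positive integer m there exists a constant C = C(m) such that: if G is any group in which every conjugacy class has size at most m (i.e., |x^G| ≤ m for every x ∈ G), then the commutator subgroup G' is finite of order at most C. -/
section BoundedConjugacyClasses

open scoped commutatorElement

variable {G : Type*} [Group G]

theorem mem_conjSet_univ_iff {x g : G} :
    g ∈ conjSet x (Set.univ : Set G) ↔ ∃ h : G, h * x * h⁻¹ = g := by
  simp only [conjSet, Set.image_univ, Set.mem_range]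
  constructor
  · rintro ⟨h, rfl⟩
    exact ⟨h⁻¹, by simp⟩
  · rintro ⟨h, rfl⟩
    exact ⟨h⁻¹, by simp⟩

/-- If the conjugacy class `K a` is the largest one, with `b c` conjugating `a` to `c`, and `u`
centralizes every `b c`, then every commutator `⁅u, y⁆` is a quotient of two elements of `K a`. -/
theorem exists_commutatorElement_eq_inv_mul_of_card_le {K : G → Finset G}
    (hK : ∀ x g, g ∈ K x ↔ ∃ h : G, h * x * h⁻¹ = g) {a : G}
    (ha : ∀ x, (K x).card ≤ (K a).card) {b : G → G}
    (hb : ∀ c ∈ K a, b c * a * (b c)⁻¹ = c) {u : G}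
    (hu : ∀ c ∈ K a, u * b c * u⁻¹ = b c) (y : G) :
    ∃ d ∈ K a, ∃ c ∈ K a, ⁅u, y⁆ = d⁻¹ * c := by
  classical
  have hsub : (K a).image (· * u) ⊆ K (a * u) := by
    intro g hg
    obtain ⟨c, hc, rfl⟩ := Finset.mem_image.mp hg
    refine (hK _ _).mpr ⟨b c, ?_⟩
    have hcomm : u * (b c)⁻¹ = (b c)⁻¹ * u := by
      have h : u * b c = b c * u := by
        rw [← mul_inv_eq_iff_eq_mul]; exact hu c hc
      exact (Commute.inv_right (show Commute u (b c) from h)).eq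
    calc b c * (a * u) * (b c)⁻¹ = b c * a * (u * (b c)⁻¹) := by group
      _ = b c * a * (b c)⁻¹ * u := by rw [hcomm]; group
      _ = c * u := by rw [hb c hc]
  have heq : (K a).image (· * u) = K (a * u) := by
    refine Finset.eq_of_subset_of_card_le hsub ?_
    rw [Finset.card_image_of_injective _ (mul_left_injective u)]
    exact ha _
  have hy : y * (a * u) * y⁻¹ ∈ (K a).image (· * u) := by
    rw [heq]
    exact (hK _ _).mpr ⟨y, rfl⟩
  obtain ⟨d, hd, hdu⟩ := Finset.mem_image.mp hy
  refine ⟨d, hd, y * a * y⁻¹, (hK _ _).mpr ⟨y, rfl⟩, ?_⟩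
  have hd' : d = y * (a * u) * y⁻¹ * u⁻¹ := eq_mul_inv_of_mul_eq hdu
  rw [hd', commutatorElement_def]
  group

theorem exists_finset_commutatorSet_subset {m : ℕ} {K : G → Finset G}
    (hK : ∀ x g, g ∈ K x ↔ ∃ h : G, h * x * h⁻¹ = g) (hm : ∀ x, (K x).card ≤ m) :
    ∃ W : Finset G, commutatorSet G ⊆ W ∧ W.card ≤ m ^ m * (m * (m * m)) := by
  classical
  have hpos : 0 < m :=
    (Finset.card_pos.mpr ⟨1, (hK 1 1).mpr ⟨1, by simp⟩⟩).trans_le (hm 1)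
  obtain ⟨a, ha⟩ : ∃ a, ∀ x, (K x).card ≤ (K a).card := by
    have hfin : (Set.range fun x => (K x).card).Finite :=
      (Set.finite_Iic m).subset (by rintro _ ⟨x, rfl⟩; exact hm x)
    obtain ⟨_, ⟨a, rfl⟩, ha⟩ := Set.exists_max_image _ id hfin (Set.range_nonempty _)
    exact ⟨a, fun x => ha _ ⟨x, rfl⟩⟩
  have hex : ∀ c, ∃ h, c ∈ K a → h * a * h⁻¹ = c := fun c => by
    by_cases hc : c ∈ K a
    · obtain ⟨h, hh⟩ := (hK _ _).mp hc
      exact ⟨h, fun _ => hh⟩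
    · exact ⟨1, fun h => absurd h hc⟩
  choose b hb using hex
  let φ : G → K a → G := fun x c => x * b c * x⁻¹
  let P : Finset (K a → G) := Fintype.piFinset fun c => K (b c)
  let T : Finset G := P.image (Function.invFun φ)
  have hT : T.card ≤ m ^ m := by
    refine Finset.card_image_le.trans ?_
    rw [Fintype.card_piFinset]
    calc ∏ c : K a, (K (b c)).card ≤ ∏ _c : K a, m := Finset.prod_le_prod' fun c _ => hm _
      _ = m ^ (K a).card := by simp
      _ ≤ m ^ m := Nat.pow_le_pow_right hpos (hm a)
  refine ⟨T.biUnion fun t => (K a ×ˢ (K a ×ˢ K t⁻¹)).image fun p => t * (p.1⁻¹ * p.2.1) * p.2.2,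
    ?_, ?_⟩
  · rintro _ ⟨x, y, rfl⟩
    obtain ⟨t, ht, htx⟩ : ∃ t ∈ T, φ t = φ x :=
      ⟨Function.invFun φ (φ x), Finset.mem_image_of_mem _
        (Fintype.mem_piFinset.mpr fun c => (hK _ _).mpr ⟨x, rfl⟩), Function.invFun_eq ⟨x, rfl⟩⟩
    have hu : ∀ c ∈ K a, (t⁻¹ * x) * b c * (t⁻¹ * x)⁻¹ = b c := fun c hc => by
      have h : t * b c * t⁻¹ = x * b c * x⁻¹ := congrFun htx ⟨c, hc⟩
      calc (t⁻¹ * x) * b c * (t⁻¹ * x)⁻¹ = t⁻¹ * (x * b c * x⁻¹) * t := by group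
        _ = b c := by rw [← h]; group
    obtain ⟨d, hd, c, hc, hdc⟩ := exists_commutatorElement_eq_inv_mul_of_card_le hK ha hb hu y
    refine Finset.mem_biUnion.mpr ⟨t, ht, Finset.mem_image.mpr ⟨(d, c, y * t⁻¹ * y⁻¹), ?_, ?_⟩⟩
    · simpa only [Finset.mem_product] using ⟨hd, hc, (hK _ _).mpr ⟨y, rfl⟩⟩
    · simp only [← hdc, commutatorElement_def]
      group
  · refine (Finset.card_biUnion_le_card_mul _ _ (m * (m * m)) fun t _ => ?_).trans
      (Nat.mul_le_mul_right _ hT)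
    refine Finset.card_image_le.trans ?_
    rw [Finset.card_product, Finset.card_product]
    exact Nat.mul_le_mul (hm _) (Nat.mul_le_mul (hm _) (hm _))

end BoundedConjugacyClasses

theorem cardCommutatorBound_mono : Monotone Subgroup.cardCommutatorBound := by
  intro k n hkn
  obtain rfl | hk := Nat.eq_zero_or_pos k
  · obtain rfl | hn := Nat.eq_zero_or_pos n
    · rfl
    · simpa [Subgroup.cardCommutatorBound] using Nat.one_le_pow _ _ (Nat.pow_pos hn)
  · have hn : 0 < n := hk.trans_le hkn
    unfold Subgroup.cardCommutatorBound
    gcongr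
    exact Nat.pow_pos hn

/-- B. H. Neumann's theorem: for every positive integer `m` there exists a constant `C = C(m)`
such that: if `G` is any group in which every conjugacy class has size at most `m`
(i.e. `|x^G| ≤ m` for every `x ∈ G`), then the commutator subgroup `G'` is finite of order
at most `C`. -/
theorem neumann_bfc (m : ℕ) (hm : 0 < m) :
    ∃ C : ℕ, ∀ (G : Type*) [Group G],
      (∀ x : G, (conjSet x (Set.univ : Set G)).Finite ∧
        (conjSet x (Set.univ : Set G)).ncard ≤ m) →
      Finite (commutator G) ∧ Nat.card (commutator G) ≤ C := by
  refine ⟨Subgroup.cardCommutatorBound (m ^ m * (m * (m * m))), fun G _ hG => ?_⟩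
  obtain ⟨W, hW, hcard⟩ := exists_finset_commutatorSet_subset (K := fun x => (hG x).1.toFinset)
    (fun x g => by rw [Set.Finite.mem_toFinset, mem_conjSet_univ_iff])
    (fun x => by rw [← Set.ncard_eq_toFinset_card _ (hG x).1]; exact (hG x).2)
  have : Finite (commutatorSet G) := W.finite_toSet.subset hW
  refine ⟨inferInstance, (Subgroup.card_commutator_le_of_finite_commutatorSet G).trans
    (cardCommutatorBound_mono (le_trans ?_ hcard))⟩
  rw [Nat.card_coe_set_eq, ← Set.ncard_coe_finset W]
  exact Set.ncard_le_ncard hW W.finite_toSet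
end
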